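/- arXiv:2203.14598 — 2 statements merged into one kernel-verified Lean document; each statement's English description precedes it below -/
import Mathlib

section
/- Let Γ = ⟨S_Γ⟩ and Λ = ⟨S_Λ⟩ be finitely generated groups with fixed finite generating systems. Then Γ and Λ admit p.m.p. essentially free actions that are isometric orbit equivalent if and only if the Cayley graphs (Γ,S_Γ) and (Λ,S_Λ) are isometric (i.e. there exists a bijective isometry between them). -/
open MeasureTheory

namespace IOE

/-- Word length of a group element with respect to a set `S`, valued in `ℕ∞`
(`⊤` if the element is not a product of elements of `S`). -/
noncomputable def wlen {G : Type*} [Group G] (S : Set G) (g : G) : ℕ∞ :=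
  sInf {n : ℕ∞ | ∃ l : List G, (∀ s ∈ l, s ∈ S) ∧ l.prod = g ∧ (l.length : ℕ∞) = n}

/-- A generating system: a symmetric generating set not containing the identity. -/
structure IsGenSystem {G : Type*} [Group G] (S : Set G) : Prop where
  inv_mem : ∀ s ∈ S, s⁻¹ ∈ S
  one_not_mem : (1 : G) ∉ S
  closure_eq_top : Subgroup.closure S = ⊤

/-- A finite generating system. -/
structure IsFinGenSystem {G : Type*} [Group G] (S : Set G) extends IsGenSystem S : Prop where
  finite : S.Finite

/-- The extended graph metric on `X` associated with an action `act` of `G` on `X`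
and a set `S ⊆ G`: the length of a shortest `S`-path from `x` to `y`. -/
noncomputable def gdist {G X : Type*} (act : G → X → X) (S : Set G) (x y : X) : ℕ∞ :=
  sInf {n : ℕ∞ | ∃ l : List G, (∀ s ∈ l, s ∈ S) ∧ l.foldr act x = y ∧ (l.length : ℕ∞) = n}

/-- A set is saturated if it is a union of connected components of the graphing. -/
def Saturated {G X : Type*} (act : G → X → X) (S : Set G) (A : Set X) : Prop :=
  ∀ x ∈ A, ∀ y : X, gdist act S x y ≠ ⊤ → y ∈ A

/-- `act` is a probability-measure-preserving action of `G` on `(X, μ)`. -/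
structure IsPmpAction {G X : Type*} [Group G] [MeasurableSpace X]
    (act : G → X → X) (μ : Measure X) : Prop where
  one_act : ∀ x, act 1 x = x
  mul_act : ∀ g h x, act (g * h) x = act g (act h x)
  measurePreserving : ∀ g, MeasurePreserving (act g) μ μ

/-- An action is essentially free if almost every point has trivial stabilizer. -/
def EssentiallyFree {G X : Type*} [Group G] [MeasurableSpace X]
    (act : G → X → X) (μ : Measure X) : Prop :=
  ∀ᵐ x ∂μ, ∀ g : G, act g x = x → g = 1

/-- Two actions are isometric orbit equivalent: there is a measure-preserving
bimeasurable bijection which is an isometry between the graphings, on a saturated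
conull set. -/
def IsomOrbitEquiv {G H X Y : Type*} [MeasurableSpace X] [MeasurableSpace Y]
    (actA : G → X → X) (SG : Set G) (μ : Measure X)
    (actB : H → Y → Y) (SH : Set H) (ν : Measure Y) : Prop :=
  ∃ Φ : X ≃ Y, Measurable Φ ∧ Measurable Φ.symm ∧ MeasurePreserving Φ μ ν ∧
    ∃ X₀ : Set X, μ X₀ᶜ = 0 ∧ Saturated actA SG X₀ ∧ Saturated actB SH (Φ '' X₀) ∧
      ∀ x ∈ X₀, ∀ x' ∈ X₀, gdist actB SH (Φ x) (Φ x') = gdist actA SG x x'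

/-- A measurable cocycle `σ : G × X → H` for the action `act` of `G` on `(X, μ)`. -/
def IsCocycle {G H X : Type*} [Group G] [Group H] [MeasurableSpace X]
    (act : G → X → X) (μ : Measure X) (σ : G → X → H) : Prop :=
  (∀ (g : G) (h : H), MeasurableSet {x | σ g x = h}) ∧
  ∀ g h : G, ∀ᵐ x ∂μ, σ (g * h) x = σ g (act h x) * σ h x

/-- A cocycle is length-preserving if it preserves the word lengths almost surely. -/
def LengthPreservingCocycle {G H X : Type*} [Group G] [Group H] [MeasurableSpace X]
    (SG : Set G) (SH : Set H) (μ : Measure X) (σ : G → X → H) : Prop :=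
  ∀ g : G, ∀ᵐ x ∂μ, wlen SH (σ g x) = wlen SG g

end IOE
namespace IOE

variable {Γ Λ Ξ : Type*} [Group Γ] [Group Λ] [Group Ξ]

/-- A bijective isometry between the Cayley graphs `(Γ, S)` and `(Λ, T)`. -/
structure CayleyIso (S : Set Γ) (T : Set Λ) where
  toEquiv : Γ ≃ Λ
  isom : ∀ a b : Γ, wlen T ((toEquiv a)⁻¹ * toEquiv b) = wlen S (a⁻¹ * b)

namespace CayleyIso

variable {S : Set Γ} {T : Set Λ} {U : Set Ξ}

@[ext] theorem ext {f g : CayleyIso S T} (h : ∀ x, f.toEquiv x = g.toEquiv x) : f = g := by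
  cases f; cases g
  simp only [mk.injEq]
  exact Equiv.ext h

/-- Composition of Cayley isometries (`comp g f` applies `f` first). -/
def comp (g : CayleyIso T U) (f : CayleyIso S T) : CayleyIso S U where
  toEquiv := f.toEquiv.trans g.toEquiv
  isom := fun a b => by
    simpa [Equiv.trans_apply] using (g.isom (f.toEquiv a) (f.toEquiv b)).trans (f.isom a b)

/-- The inverse of a Cayley isometry. -/
def inv (f : CayleyIso S T) : CayleyIso T S where
  toEquiv := f.toEquiv.symm
  isom := fun a b => by
    simpa using (f.isom (f.toEquiv.symm a) (f.toEquiv.symm b)).symm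

/-- The identity Cayley isometry. -/
def refl (S : Set Γ) : CayleyIso S S := ⟨Equiv.refl Γ, fun _ _ => rfl⟩

/-- The group `Iso(Γ)` of bijective isometries of the Cayley graph `(Γ, S)`,
under composition. -/
instance : Group (CayleyIso S S) where
  mul f g := comp f g
  one := refl S
  inv := inv
  mul_assoc f g h := ext fun x => rfl
  one_mul f := ext fun x => rfl
  mul_one f := ext fun x => rfl
  inv_mul_cancel f := ext fun x => f.toEquiv.symm_apply_apply x

@[simp] theorem mul_apply (f g : CayleyIso S S) (x : Γ) :
    (f * g).toEquiv x = f.toEquiv (g.toEquiv x) := rfl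

@[simp] theorem one_apply (x : Γ) : (1 : CayleyIso S S).toEquiv x = x := rfl

@[simp] theorem inv_apply (f : CayleyIso S S) (x : Γ) :
    (f⁻¹).toEquiv x = f.toEquiv.symm x := rfl

/-- Left multiplication by a group element, as a Cayley isometry. -/
def leftMult (S : Set Γ) (γ : Γ) : CayleyIso S S where
  toEquiv := Equiv.mulLeft γ
  isom := fun a b => by
    simp only [Equiv.coe_mulLeft]
    congr 1
    group

@[simp] theorem leftMult_apply (γ x : Γ) : (leftMult S γ).toEquiv x = γ * x := rfl

/-- Post-composition by left multiplication. -/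
def lsmul (lam : Λ) (f : CayleyIso S T) : CayleyIso S T where
  toEquiv := f.toEquiv.trans (Equiv.mulLeft lam)
  isom := fun a b => by
    simp only [Equiv.trans_apply, Equiv.coe_mulLeft]
    rw [show (lam * f.toEquiv a)⁻¹ * (lam * f.toEquiv b)
        = (f.toEquiv a)⁻¹ * f.toEquiv b by group, f.isom]

@[simp] theorem lsmul_apply (lam : Λ) (f : CayleyIso S T) (x : Γ) :
    (lsmul lam f).toEquiv x = lam * f.toEquiv x := rfl

/-- The action of `Λ` on `Iso(Γ,Λ)` by post-composition. -/
instance : MulAction Λ (CayleyIso S T) where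
  smul := lsmul
  one_smul f := ext fun x => one_mul _
  mul_smul a b f := ext fun x => mul_assoc a b _

@[simp] theorem smul_apply (lam : Λ) (f : CayleyIso S T) (x : Γ) :
    (lam • f).toEquiv x = lam * f.toEquiv x := rfl

/-- The σ-algebra of pointwise convergence on `Iso(Γ,Λ)`. -/
instance : MeasurableSpace (CayleyIso S T) :=
  MeasurableSpace.comap (fun f (γ : Γ) => f.toEquiv γ)
    (@MeasurableSpace.pi Γ (fun _ => Λ) (fun _ => ⊤))

/-- The topology of pointwise convergence on `Iso(Γ,Λ)`. -/
instance : TopologicalSpace (CayleyIso S T) :=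
  TopologicalSpace.induced (fun f (γ : Γ) => f.toEquiv γ)
    (@Pi.topologicalSpace Γ (fun _ => Λ) (fun _ => ⊥))

end CayleyIso

/-- `Iso₁(Γ,Λ)`: the bijective isometries between the Cayley graphs sending `1` to `1`. -/
def Iso1 {Γ Λ : Type*} [Group Γ] [Group Λ] (S : Set Γ) (T : Set Λ) : Type _ :=
  {f : CayleyIso S T // f.toEquiv 1 = 1}

namespace Iso1

variable {S : Set Γ} {T : Set Λ}

instance : MeasurableSpace (Iso1 S T) := by unfold Iso1; infer_instance
instance : TopologicalSpace (Iso1 S T) := by unfold Iso1; infer_instance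

/-- The natural action of `Γ` on `Iso₁(Γ,Λ)`: `(γ · f)(δ) = f(γ⁻¹)⁻¹ f(γ⁻¹δ)`. -/
def natAct (γ : Γ) (f : Iso1 S T) : Iso1 S T :=
  ⟨CayleyIso.lsmul (f.1.toEquiv γ⁻¹)⁻¹ (CayleyIso.comp f.1 (CayleyIso.leftMult S γ⁻¹)), by
    show (f.1.toEquiv γ⁻¹)⁻¹ * f.1.toEquiv (γ⁻¹ * 1) = 1
    rw [mul_one, inv_mul_cancel]⟩

@[simp] theorem natAct_apply (γ : Γ) (f : Iso1 S T) (δ : Γ) :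
    (natAct γ f).1.toEquiv δ = (f.1.toEquiv γ⁻¹)⁻¹ * f.1.toEquiv (γ⁻¹ * δ) := rfl

/-- Pre-composition by an element of `Iso₁(Γ)`. -/
def pre1 (h : Iso1 S S) (f : Iso1 S T) : Iso1 S T :=
  ⟨CayleyIso.comp f.1 h.1, by show f.1.toEquiv (h.1.toEquiv 1) = 1; rw [h.2, f.2]⟩

/-- Post-composition by an element of `Iso₁(Λ)`. -/
def post1 (k : Iso1 T T) (f : Iso1 S T) : Iso1 S T :=
  ⟨CayleyIso.comp k.1 f.1, by show k.1.toEquiv (f.1.toEquiv 1) = 1; rw [f.2, k.2]⟩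

/-- The inverse map `Iso₁(Γ,Λ) → Iso₁(Λ,Γ)`. -/
def inv1 (f : Iso1 S T) : Iso1 T S :=
  ⟨f.1.inv, by
    show f.1.toEquiv.symm 1 = 1
    exact (Equiv.symm_apply_eq _).mpr f.2.symm⟩

/-- The inverse map, as a bijection `Iso₁(Γ,Λ) ≃ Iso₁(Λ,Γ)`. -/
def invEquiv1 : Iso1 S T ≃ Iso1 T S where
  toFun := inv1
  invFun := inv1
  left_inv f := Subtype.ext (CayleyIso.ext fun x => by simp [inv1, CayleyIso.inv])
  right_inv f := Subtype.ext (CayleyIso.ext fun x => by simp [inv1, CayleyIso.inv])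

end Iso1

end IOE

namespace IOE

section WordLength

variable {G : Type*} [Group G] {S : Set G}

theorem exists_list_prod_eq (hS : IsGenSystem S) (g : G) :
    ∃ l : List G, (∀ s ∈ l, s ∈ S) ∧ l.prod = g := by
  have hg : g ∈ (Subgroup.closure S).toSubmonoid := by rw [hS.closure_eq_top]; trivial
  rw [Subgroup.closure_toSubmonoid] at hg
  obtain ⟨l, hl, rfl⟩ := Submonoid.exists_list_of_mem_closure hg
  exact ⟨l, fun s hs => (hl s hs).elim id fun h => by simpa using hS.inv_mem _ h, rfl⟩

theorem exists_list_of_wlen_eq {g : G} {n : ℕ} (h : wlen S g = n) :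
    ∃ l : List G, (∀ s ∈ l, s ∈ S) ∧ l.prod = g ∧ l.length = n := by
  have hne : {n : ℕ∞ | ∃ l : List G, (∀ s ∈ l, s ∈ S) ∧ l.prod = g ∧
      (l.length : ℕ∞) = n}.Nonempty := by
    by_contra hc
    rw [Set.not_nonempty_iff_eq_empty] at hc
    rw [wlen, hc, sInf_empty] at h
    exact ENat.top_ne_natCast n h
  obtain ⟨l, hl, hg, hn⟩ := csInf_mem hne
  refine ⟨l, hl, hg, ?_⟩
  rw [wlen] at h
  exact_mod_cast hn.trans h

theorem wlen_prod_le {l : List G} (hl : ∀ s ∈ l, s ∈ S) : wlen S l.prod ≤ l.length :=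
  sInf_le ⟨l, hl, rfl, rfl⟩

theorem wlen_ne_top (hS : IsGenSystem S) (g : G) : wlen S g ≠ ⊤ := by
  obtain ⟨l, hl, rfl⟩ := exists_list_prod_eq hS g
  exact ne_top_of_le_ne_top (ENat.natCast_ne_top _) (wlen_prod_le hl)

theorem wlen_eq_one_iff (hS : IsGenSystem S) {g : G} : wlen S g = 1 ↔ g ∈ S := by
  constructor
  · intro h
    obtain ⟨l, hl, rfl, hn⟩ := exists_list_of_wlen_eq (n := 1) (by simpa using h)
    obtain ⟨a, rfl⟩ := List.length_eq_one_iff.1 hn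
    simpa using hl
  · intro h
    have hle : wlen S g ≤ 1 := by
      simpa using wlen_prod_le (S := S) (l := [g]) (by simpa using h)
    refine hle.antisymm (Order.one_le_iff_pos.2 (pos_iff_ne_zero.2 fun h0 => ?_))
    obtain ⟨l, -, rfl, hn⟩ := exists_list_of_wlen_eq (n := 0) (by simpa using h0)
    rw [List.length_eq_zero_iff] at hn
    subst hn
    exact hS.one_not_mem h

theorem finite_setOf_wlen_eq (hS : IsFinGenSystem S) (n : ℕ∞) : {g | wlen S g = n}.Finite := by
  induction n using ENat.recTopCoe with
  | top => simp [wlen_ne_top hS.toIsGenSystem]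
  | coe n =>
    have hfin : ∀ n : ℕ,
        {g : G | ∃ l : List G, (∀ s ∈ l, s ∈ S) ∧ l.prod = g ∧ l.length = n}.Finite := by
      intro n
      induction n with
      | zero =>
        refine (Set.finite_singleton (1 : G)).subset ?_
        rintro g ⟨l, -, rfl, hn⟩
        rw [List.length_eq_zero_iff] at hn
        simp [hn]
      | succ n ih =>
        refine (Set.Finite.image2 (· * ·) hS.finite ih).subset ?_
        rintro g ⟨l, hl, rfl, hn⟩
        obtain ⟨a, l, rfl⟩ := List.exists_cons_of_length_eq_add_one hn
        exact ⟨a, hl a (by simp), l.prod, ⟨l, fun s hs => hl s (by simp [hs]), rfl, by simpa using hn⟩,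
          by simp⟩
    exact (hfin n).subset fun g hg => exists_list_of_wlen_eq hg

theorem countable_of_isFinGenSystem (hS : IsFinGenSystem S) : Countable G := by
  rw [← Set.countable_univ_iff]
  refine (Set.countable_iUnion fun n : ℕ => (finite_setOf_wlen_eq hS n).countable).mono ?_
  intro g _
  lift wlen S g to ℕ using wlen_ne_top hS.toIsGenSystem g with n hn
  exact Set.mem_iUnion.2 ⟨n, hn.symm⟩

end WordLength

section Graphing

variable {G H X : Type*}

theorem foldr_eq_prod_act [Group G] {act : G → X → X} (h1 : ∀ x, act 1 x = x)
    (hm : ∀ g h x, act (g * h) x = act g (act h x)) (l : List G) (x : X) :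
    l.foldr act x = act l.prod x := by
  induction l with
  | nil => simp [h1]
  | cons a l ih => simp [ih, hm]

theorem gdist_act_act [Group G] {act : G → X → X} (h1 : ∀ x, act 1 x = x)
    (hm : ∀ g h x, act (g * h) x = act g (act h x)) (S : Set G) {x : X}
    (hx : ∀ g, act g x = x → g = 1) (a b : G) :
    gdist act S (act a x) (act b x) = wlen S (b * a⁻¹) := by
  have key : ∀ g, act g (act a x) = act b x ↔ g = b * a⁻¹ := by
    intro g
    constructor
    · intro h
      have h' : act (b⁻¹ * (g * a)) x = x := by
        rw [hm, hm, h, ← hm, inv_mul_cancel, h1]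
      have := hx _ h'
      rw [eq_mul_inv_iff_mul_eq]
      exact (inv_mul_eq_one.1 this).symm
    · rintro rfl
      rw [← hm, inv_mul_cancel_right]
  simp only [gdist, wlen, foldr_eq_prod_act h1 hm, key]

theorem exists_act_of_gdist_ne_top [Group G] {act : G → X → X} (h1 : ∀ x, act 1 x = x)
    (hm : ∀ g h x, act (g * h) x = act g (act h x)) {S : Set G} {x y : X}
    (h : gdist act S x y ≠ ⊤) : ∃ g, act g x = y := by
  by_contra! hc
  apply h
  rw [gdist, sInf_eq_top]
  rintro n ⟨l, -, hl, -⟩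
  rw [foldr_eq_prod_act h1 hm] at hl
  exact absurd hl (hc _)

theorem gdist_le_of_edges {actA : G → X → X} {actB : H → X → X} {S : Set G} {T : Set H}
    (h : ∀ x, ∀ s ∈ S, ∃ t ∈ T, actB t x = actA s x) (x y : X) :
    gdist actB T x y ≤ gdist actA S x y := by
  refine le_sInf ?_
  rintro n ⟨l, hl, rfl, rfl⟩
  refine sInf_le ?_
  induction l with
  | nil => exact ⟨[], by simp, rfl, rfl⟩
  | cons a l ih =>
    obtain ⟨l', hl', hx, hn⟩ := ih fun s hs => hl s (by simp [hs])
    obtain ⟨t, ht, hta⟩ := h (l.foldr actA x) a (hl a (by simp))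
    refine ⟨t :: l', by simpa [ht] using hl', by simp [hx, hta], ?_⟩
    rw [Nat.cast_inj] at hn
    simp [hn]

end Graphing

/-- Isometric orbit equivalent essentially free actions yield isometric Cayley graphs. -/
theorem nonempty_cayleyIso_of_isomOrbitEquiv {Γ Λ X Y : Type*} [Group Γ] [Group Λ]
    [MeasurableSpace X] [MeasurableSpace Y] {SΓ : Set Γ} {SΛ : Set Λ} {μ : Measure X}
    {ν : Measure Y} [NeZero μ] {α : Γ → X → X} {β : Λ → Y → Y}
    (hSΓ : IsGenSystem SΓ) (hSΛ : IsGenSystem SΛ)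
    (hα : IsPmpAction α μ) (hβ : IsPmpAction β ν) (hfα : EssentiallyFree α μ)
    (hfβ : EssentiallyFree β ν) (h : IsomOrbitEquiv α SΓ μ β SΛ ν) :
    Nonempty (CayleyIso SΓ SΛ) := by
  obtain ⟨Φ, -, -, hΦ, X₀, hX₀, hsA, hsB, hiso⟩ := h
  obtain ⟨x, hxA, hxB, hx₀⟩ :=
    (hfα.and ((hΦ.quasiMeasurePreserving.ae hfβ).and (mem_ae_iff.2 hX₀))).exists
  have hA : ∀ a, α a x ∈ X₀ := fun a => by
    refine hsA x hx₀ _ ?_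
    have := gdist_act_act hα.one_act hα.mul_act SΓ hxA 1 a
    rw [hα.one_act] at this
    rw [this]
    exact wlen_ne_top hSΓ _
  have hB : ∀ b, β b (Φ x) ∈ Φ '' X₀ := fun b => by
    refine hsB _ ⟨x, hx₀, rfl⟩ _ ?_
    have := gdist_act_act hβ.one_act hβ.mul_act SΛ hxB 1 b
    rw [hβ.one_act] at this
    rw [this]
    exact wlen_ne_top hSΛ _
  have hfwd : ∀ a, ∃ b, β b (Φ x) = Φ (α a x) := fun a => by
    refine exists_act_of_gdist_ne_top hβ.one_act hβ.mul_act (S := SΛ) ?_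
    rw [hiso x hx₀ _ (hA a)]
    have := gdist_act_act hα.one_act hα.mul_act SΓ hxA 1 a
    rw [hα.one_act] at this
    rw [this]
    exact wlen_ne_top hSΓ _
  have hbwd : ∀ b, ∃ a, Φ (α a x) = β b (Φ x) := fun b => by
    obtain ⟨y, hy, hyb⟩ := hB b
    obtain ⟨a, rfl⟩ : ∃ a, α a x = y := by
      refine exists_act_of_gdist_ne_top hα.one_act hα.mul_act (S := SΓ) ?_
      rw [← hiso x hx₀ _ hy, hyb]
      have := gdist_act_act hβ.one_act hβ.mul_act SΛ hxB 1 b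
      rw [hβ.one_act] at this
      rw [this]
      exact wlen_ne_top hSΛ _
    exact ⟨a, hyb⟩
  choose f hf using hfwd
  choose g hg using hbwd
  have injA : ∀ a a', α a x = α a' x → a = a' := fun a a' haa => by
    have : α (a'⁻¹ * a) x = x := by
      rw [hα.mul_act, haa, ← hα.mul_act, inv_mul_cancel, hα.one_act]
    exact (inv_mul_eq_one.1 (hxA _ this)).symm
  have injB : ∀ b b', β b (Φ x) = β b' (Φ x) → b = b' := fun b b' hbb => by
    have : β (b'⁻¹ * b) (Φ x) = Φ x := by
      rw [hβ.mul_act, hbb, ← hβ.mul_act, inv_mul_cancel, hβ.one_act]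
    exact (inv_mul_eq_one.1 (hxB _ this)).symm
  let e : Γ ≃ Λ :=
    { toFun := f
      invFun := g
      left_inv := fun a => injA _ _ (Φ.injective ((hg _).trans (hf a)))
      right_inv := fun b => injB _ _ ((hf _).trans (hg b)) }
  refine ⟨⟨(Equiv.inv Γ).trans (e.trans (Equiv.inv Λ)), fun a b => ?_⟩⟩
  have h1 := gdist_act_act hβ.one_act hβ.mul_act SΛ hxB (f b⁻¹) (f a⁻¹)
  rw [hf, hf, hiso _ (hA _) _ (hA _), gdist_act_act hα.one_act hα.mul_act SΓ hxA] at h1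
  simpa [e] using h1.symm

end IOE
namespace IOE

open scoped ENNReal

section Piecewise

variable {X ι : Type*} [MeasurableSpace X] [Countable ι] {φ : ι → X ≃ᵐ X} {k : X → ι} {T : X → X}

theorem measurable_of_piecewise (hk : ∀ i, MeasurableSet {x | k x = i})
    (hTk : ∀ x, T x = φ (k x) x) : Measurable T := by
  intro A hA
  have : T ⁻¹' A = ⋃ i, {x | k x = i} ∩ φ i ⁻¹' A := by
    ext x
    simp [hTk]
  rw [this]
  exact .iUnion fun i => (hk i).inter ((φ i).measurable hA)

/-- A bijection that agrees piecewise with maps scaling a measure by `c` scales it by `c`. -/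
theorem map_eq_smul_of_piecewise {μ : Measure X} {c : ℝ≥0∞}
    (hφ : ∀ i, μ.map (φ i) = c • μ) (hk : ∀ i, MeasurableSet {x | k x = i})
    (hT : Function.Bijective T) (hTk : ∀ x, T x = φ (k x) x) : μ.map T = c • μ := by
  ext A hA
  have hset : ∀ i, {x | k x = i} ∩ T ⁻¹' A = φ i ⁻¹' (φ i '' {x | k x = i} ∩ A) := by
    intro i
    ext x
    simp only [Set.mem_inter_iff, Set.mem_ofPred_eq, Set.mem_preimage,
      (φ i).injective.mem_set_image]
    refine and_congr_right fun hx => ?_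
    rw [hTk, hx]
  have hB : ∀ i, MeasurableSet (φ i '' {x | k x = i}) := fun i =>
    (φ i).measurableSet_image.2 (hk i)
  have hsum : ∀ (m : Measure X) (D : Set X) (B : ι → Set X), MeasurableSet D →
      (∀ i, MeasurableSet (B i)) → Pairwise (Function.onFun Disjoint B) → ⋃ i, B i = Set.univ →
      m D = ∑' i, m (B i ∩ D) := by
    intro m D B hD hBm hd hu
    rw [← measure_iUnion (fun i j hij => (hd hij).mono Set.inter_subset_left Set.inter_subset_left)
      fun i => (hBm i).inter hD, ← Set.iUnion_inter, hu, Set.univ_inter]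
  have hTm := measurable_of_piecewise hk hTk
  rw [Measure.map_apply hTm hA, hsum μ (T ⁻¹' A) (fun i => {x | k x = i}) (hTm hA) hk
    (fun i j hij => Set.disjoint_left.2 fun x hi hj => hij (hi.symm.trans hj))
    (by ext x; simp)]
  rw [hsum (c • μ) A (fun i => φ i '' {x | k x = i}) hA hB]
  · refine tsum_congr fun i => ?_
    rw [hset, ← Measure.map_apply (φ i).measurable ((hB i).inter hA), hφ]
  · refine fun i j hij => Set.disjoint_left.2 ?_
    rintro _ ⟨x, hx, rfl⟩ ⟨y, hy, hxy⟩
    simp only [Set.mem_ofPred_eq] at hx hy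
    subst hx hy
    rw [← hTk, ← hTk] at hxy
    exact hij (by rw [hT.1 hxy])
  · refine Set.eq_univ_of_forall fun y => ?_
    obtain ⟨x, rfl⟩ := hT.2 y
    exact Set.mem_iUnion.2 ⟨k x, x, rfl, (hTk x).symm⟩

end Piecewise

/-- The measurable automorphism given by an element of a group acting measurably. -/
def actEquiv {G X : Type*} [Group G] [MeasurableSpace X] {act : G → X → X}
    (h1 : ∀ x, act 1 x = x) (hm : ∀ g h x, act (g * h) x = act g (act h x))
    (hmeas : ∀ g, Measurable (act g)) (g : G) : X ≃ᵐ X where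
  toFun := act g
  invFun := act g⁻¹
  left_inv x := by rw [← hm, inv_mul_cancel, h1]
  right_inv x := by rw [← hm, mul_inv_cancel, h1]
  measurable_toFun := hmeas g
  measurable_invFun := hmeas g⁻¹

/-- A p.m.p. essentially free action with a length-preserving cocycle that is bijective at every
point is isometric orbit equivalent to an essentially free p.m.p. action of the target group. -/
theorem exists_isomOrbitEquiv_of_cocycle {Γ Λ X : Type*} [Group Γ] [Group Λ]
    [Countable Γ] {SΓ : Set Γ} {SΛ : Set Λ} (hSΓ : IsGenSystem SΓ)
    (hSΛ : IsGenSystem SΛ) [MeasurableSpace X] {μ : Measure X} {α : Γ → X → X}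
    (hα : IsPmpAction α μ) (hfree : EssentiallyFree α μ) (τ : Γ → X → Λ)
    (hτm : ∀ g l, MeasurableSet {x | τ g x = l})
    (hτmul : ∀ g h x, τ (g * h) x = τ g (α h x) * τ h x)
    (hτbij : ∀ x, Function.Bijective fun g => τ g x)
    (hτlen : ∀ g x, wlen SΛ (τ g x) = wlen SΓ g) :
    ∃ β : Λ → X → X, IsPmpAction β μ ∧ EssentiallyFree β μ ∧
      IsomOrbitEquiv α SΓ μ β SΛ μ := by
  obtain ⟨σ, hτσ⟩ : ∃ σ : Λ → X → Γ, ∀ l x, τ (σ l x) x = l := by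
    choose σ hσ using fun l x => (hτbij x).2 l
    exact ⟨σ, hσ⟩
  have hσ_eq : ∀ {l x g}, τ g x = l → σ l x = g := fun {l x g} h =>
    (hτbij x).1 ((hτσ l x).trans h.symm)
  have hτ1 : ∀ x, τ 1 x = 1 := fun x => by
    have := hτmul 1 1 x
    rw [hα.one_act, mul_one] at this
    exact left_eq_mul.1 this
  have hβ1 : ∀ x, α (σ 1 x) x = x := fun x => by rw [hσ_eq (hτ1 x), hα.one_act]
  have hβm : ∀ l m x, α (σ (l * m) x) x = α (σ l (α (σ m x) x)) (α (σ m x) x) := fun l m x => by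
    rw [← hα.mul_act]
    congr 1
    apply hσ_eq
    rw [hτmul, hτσ, hτσ]
  have hσm : ∀ l g, MeasurableSet {x | σ l x = g} := fun l g => by
    convert hτm g l using 3 with x
    exact ⟨fun h => h ▸ hτσ l x, hσ_eq⟩
  let φ : Γ → X ≃ᵐ X :=
    actEquiv hα.one_act hα.mul_act fun g => (hα.measurePreserving g).measurable
  have hbij : ∀ l, Function.Bijective fun x => α (σ l x) x := fun l => by
    refine Function.bijective_iff_has_inverse.2 ⟨fun x => α (σ l⁻¹ x) x, fun x => ?_, fun x => ?_⟩
    · change α (σ l⁻¹ (α (σ l x) x)) (α (σ l x) x) = x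
      rw [← hβm, inv_mul_cancel, hβ1]
    · change α (σ l (α (σ l⁻¹ x) x)) (α (σ l⁻¹ x) x) = x
      rw [← hβm, mul_inv_cancel, hβ1]
  have hd : ∀ x x', gdist (fun l x => α (σ l x) x) SΛ x x' = gdist α SΓ x x' := fun x x' => by
    refine le_antisymm (gdist_le_of_edges ?_ _ _) (gdist_le_of_edges ?_ _ _)
    · intro x s hs
      refine ⟨τ s x, ?_, by rw [hσ_eq rfl]⟩
      rw [← wlen_eq_one_iff hSΛ, hτlen, wlen_eq_one_iff hSΓ]
      exact hs
    · intro x s hs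
      refine ⟨σ s x, ?_, rfl⟩
      rw [← wlen_eq_one_iff hSΓ, ← hτlen _ x, hτσ, wlen_eq_one_iff hSΛ]
      exact hs
  refine ⟨fun l x => α (σ l x) x, ⟨hβ1, hβm, fun l => ⟨?_, ?_⟩⟩, ?_, Equiv.refl X,
    measurable_id, measurable_id, MeasurePreserving.id μ, Set.univ, by simp, ?_, ?_, ?_⟩
  · exact measurable_of_piecewise (φ := φ) (hσm l) fun x => rfl
  · rw [map_eq_smul_of_piecewise (φ := φ) (c := 1) (μ := μ) (fun g => ?_) (hσm l) (hbij l)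
      fun x => rfl, one_smul]
    rw [one_smul]
    exact (hα.measurePreserving g).map_eq
  · filter_upwards [hfree] with x hx l hl
    rw [← hτσ l x, hx _ hl, hτ1]
  · exact fun _ _ _ _ => trivial
  · exact fun _ _ y _ => ⟨y, trivial, rfl⟩
  · exact fun x _ x' _ => hd x x'

/-- The cocycle criterion with the action on a standard Borel space in an arbitrary universe. -/
theorem exists_actions_of_cocycle {Γ Λ X : Type*} [Group Γ] [Group Λ]
    [Countable Γ] {SΓ : Set Γ} {SΛ : Set Λ} (hSΓ : IsGenSystem SΓ)
    (hSΛ : IsGenSystem SΛ) [MeasurableSpace X] [StandardBorelSpace X] {μ : Measure X}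
    [IsProbabilityMeasure μ] {α : Γ → X → X}
    (hα : IsPmpAction α μ) (hfree : EssentiallyFree α μ) (τ : Γ → X → Λ)
    (hτm : ∀ g l, MeasurableSet {x | τ g x = l})
    (hτmul : ∀ g h x, τ (g * h) x = τ g (α h x) * τ h x)
    (hτbij : ∀ x, Function.Bijective fun g => τ g x)
    (hτlen : ∀ g x, wlen SΛ (τ g x) = wlen SΓ g) :
    ∃ (X Y : Type) (_ : MeasurableSpace X) (_ : MeasurableSpace Y)
        (μ : Measure X) (ν : Measure Y) (α : Γ → X → X) (β : Λ → Y → Y),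
      StandardBorelSpace X ∧ StandardBorelSpace Y ∧
      IsProbabilityMeasure μ ∧ IsProbabilityMeasure ν ∧
      IsPmpAction α μ ∧ IsPmpAction β ν ∧
      EssentiallyFree α μ ∧ EssentiallyFree β ν ∧
      IsomOrbitEquiv α SΓ μ β SΛ ν := by
  obtain ⟨f, hf⟩ := exists_measurableEmbedding_real X
  let e : X ≃ᵐ Set.range f := hf.equivRange
  have he : MeasurePreserving e μ (μ.map e) := e.measurable.measurePreserving μ
  have hst : StandardBorelSpace (Set.range f) := hf.measurableSet_range.standardBorel
  have hpr : IsProbabilityMeasure (μ.map e) :=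
    Measure.isProbabilityMeasure_map e.measurable.aemeasurable
  have hα' : IsPmpAction (fun g x => e (α g (e.symm x))) (μ.map e) :=
    { one_act := fun x => by simp [hα.one_act]
      mul_act := fun g h x => by simp [hα.mul_act]
      measurePreserving := fun g =>
        he.comp ((hα.measurePreserving g).comp (he.symm e)) }
  have hfree' : EssentiallyFree (fun g x => e (α g (e.symm x))) (μ.map e) := by
    have := (he.symm e).quasiMeasurePreserving.ae hfree
    filter_upwards [this] with x hx g hg
    exact hx g (by simpa using congrArg e.symm hg)
  obtain ⟨β, hβ, hβf, hoe⟩ := exists_isomOrbitEquiv_of_cocycle hSΓ hSΛ hα' hfree'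
    (fun g x => τ g (e.symm x)) (fun g l => e.symm.measurable (hτm g l))
    (fun g h x => by simp [hτmul]) (fun x => hτbij _) (fun g x => hτlen _ _)
  exact ⟨Set.range f, Set.range f, inferInstance, inferInstance, μ.map e, μ.map e, _, β,
    hst, hst, hpr, hpr, hα', hβ, hfree', hβf, hoe⟩

end IOE
namespace IOE

open Topology

namespace CayleyIso

variable {Γ Λ : Type*} [Group Γ] [Group Λ] {S : Set Γ} {T : Set Λ}

theorem isOpen_setOf_apply_eq (x : Γ) (y : Λ) : IsOpen {f : CayleyIso S T | f.toEquiv x = y} := by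
  let _ : TopologicalSpace Λ := ⊥
  have : DiscreteTopology Λ := ⟨rfl⟩
  have h : Continuous fun f : CayleyIso S T => fun γ => f.toEquiv γ := continuous_induced_dom
  exact (isOpen_discrete {y}).preimage ((continuous_apply x).comp h)

theorem continuous_of_isOpen {Z : Type*} [TopologicalSpace Z] {φ : Z → CayleyIso S T}
    (h : ∀ x y, IsOpen {z | (φ z).toEquiv x = y}) : Continuous φ := by
  let _ : TopologicalSpace Λ := ⊥
  have : DiscreteTopology Λ := ⟨rfl⟩
  refine continuous_induced_rng.2 (continuous_pi fun x => continuous_discrete_rng.2 fun y => ?_)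
  exact h x y

instance : IsTopologicalGroup (CayleyIso S S) where
  continuous_mul := by
    refine continuous_of_isOpen fun x y => ?_
    have : {p : CayleyIso S S × CayleyIso S S | (p.1 * p.2).toEquiv x = y} =
        ⋃ z, {f : CayleyIso S S | f.toEquiv z = y} ×ˢ {g : CayleyIso S S | g.toEquiv x = z} := by
      ext p
      simp
    rw [this]
    exact isOpen_iUnion fun z => (isOpen_setOf_apply_eq z y).prod (isOpen_setOf_apply_eq x z)
  continuous_inv := by
    refine continuous_of_isOpen fun x y => ?_
    convert isOpen_setOf_apply_eq (S := S) (T := S) y x using 3 with f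
    rw [inv_apply, Equiv.symm_apply_eq, eq_comm]

theorem isClosedEmbedding_prod [TopologicalSpace Γ] [DiscreteTopology Γ] [TopologicalSpace Λ]
    [DiscreteTopology Λ] : IsClosedEmbedding
      fun f : CayleyIso S T => ((f.toEquiv : Γ → Λ), (f.toEquiv.symm : Λ → Γ)) := by
  have hc : Continuous
      fun f : CayleyIso S T => ((f.toEquiv : Γ → Λ), (f.toEquiv.symm : Λ → Γ)) := by
    refine .prodMk (continuous_pi fun x => continuous_discrete_rng.2 fun y =>
      isOpen_setOf_apply_eq x y) (continuous_pi fun x => continuous_discrete_rng.2 fun y => ?_)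
    convert isOpen_setOf_apply_eq (S := S) (T := T) y x using 1
    ext f
    exact (Equiv.symm_apply_eq _).trans eq_comm
  have hind : IsInducing fun f : CayleyIso S T => fun x => f.toEquiv x := by
    refine ⟨?_⟩
    rw [DiscreteTopology.eq_bot (α := Λ)]
    rfl
  refine ⟨⟨.of_comp hc continuous_fst hind, fun f g h => ?_⟩, ?_⟩
  · exact ext fun x => congrFun (congrArg Prod.fst h) x
  · have hr : Set.range (fun f : CayleyIso S T =>
        ((f.toEquiv : Γ → Λ), (f.toEquiv.symm : Λ → Γ))) =
        {p | (∀ x, p.2 (p.1 x) = x) ∧ (∀ y, p.1 (p.2 y) = y) ∧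
          ∀ a b, wlen T ((p.1 a)⁻¹ * p.1 b) = wlen S (a⁻¹ * b)} := by
      ext ⟨u, v⟩
      constructor
      · rintro ⟨f, hf⟩
        simp only [Prod.mk.injEq] at hf
        obtain ⟨rfl, rfl⟩ := hf
        exact ⟨fun x => f.toEquiv.symm_apply_apply x, fun y => f.toEquiv.apply_symm_apply y,
          f.isom⟩
      · rintro ⟨h1, h2, h3⟩
        exact ⟨⟨⟨u, v, h1, h2⟩, h3⟩, rfl⟩
    rw [hr]
    have hev : ∀ (x : Γ), Continuous fun p : (Γ → Λ) × (Λ → Γ) => p.1 x := fun x =>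
      (continuous_apply x).comp continuous_fst
    have hev' : ∀ (x : Λ), Continuous fun p : (Γ → Λ) × (Λ → Γ) => p.2 x := fun x =>
      (continuous_apply x).comp continuous_snd
    have happ : Continuous fun q : (Γ → Λ) × Γ => q.1 q.2 :=
      continuous_prod_of_discrete_right.2 fun x => continuous_apply x
    have happ' : Continuous fun q : (Λ → Γ) × Λ => q.1 q.2 :=
      continuous_prod_of_discrete_right.2 fun y => continuous_apply y
    have hset : {p : (Γ → Λ) × (Λ → Γ) | (∀ x, p.2 (p.1 x) = x) ∧ (∀ y, p.1 (p.2 y) = y) ∧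
          ∀ a b, wlen T ((p.1 a)⁻¹ * p.1 b) = wlen S (a⁻¹ * b)} =
        (⋂ x, {p | p.2 (p.1 x) = x}) ∩ ((⋂ y, {p | p.1 (p.2 y) = y}) ∩
          ⋂ a, ⋂ b, {p | wlen T ((p.1 a)⁻¹ * p.1 b) = wlen S (a⁻¹ * b)}) := by
      ext p
      simp
    rw [hset]
    refine (isClosed_iInter fun x => ?_).inter ((isClosed_iInter fun y => ?_).inter
      (isClosed_iInter fun a => isClosed_iInter fun b => ?_))
    · exact isClosed_eq (happ'.comp (continuous_snd.prodMk (hev x))) continuous_const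
    · exact isClosed_eq (happ.comp (continuous_fst.prodMk (hev' y))) continuous_const
    · have hd : Continuous fun q : Λ × Λ => wlen T (q.1⁻¹ * q.2) := continuous_of_discreteTopology
      exact isClosed_eq (hd.comp ((hev a).prodMk (hev b))) continuous_const

theorem polishSpace [Countable Γ] [Countable Λ] : PolishSpace (CayleyIso S T) := by
  let _ : TopologicalSpace Γ := ⊥
  have : DiscreteTopology Γ := ⟨rfl⟩
  let _ : TopologicalSpace Λ := ⊥
  have : DiscreteTopology Λ := ⟨rfl⟩
  have : PolishSpace Γ := inferInstance
  have : PolishSpace Λ := inferInstance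
  have : PolishSpace ((Γ → Λ) × (Λ → Γ)) := inferInstance
  exact isClosedEmbedding_prod.polishSpace

instance [Countable Γ] [Countable Λ] : BorelSpace (CayleyIso S T) := by
  let _ : TopologicalSpace Λ := ⊥
  have : DiscreteTopology Λ := ⟨rfl⟩
  let _ : MeasurableSpace Λ := ⊤
  have : BorelSpace Λ := inferInstance
  refine ⟨?_⟩
  have h : borel (CayleyIso S T) = (borel (Γ → Λ)).comap fun f γ => f.toEquiv γ := borel_comap
  rw [h, ← BorelSpace.measurable_eq (α := Γ → Λ)]
  rfl

theorem isCompact_setOf_apply_one_eq_one (hS : IsFinGenSystem S) (hT : IsFinGenSystem T) :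
    IsCompact {f : CayleyIso S T | f.toEquiv 1 = 1} := by
  let _ : TopologicalSpace Γ := ⊥
  have : DiscreteTopology Γ := ⟨rfl⟩
  let _ : TopologicalSpace Λ := ⊥
  have : DiscreteTopology Λ := ⟨rfl⟩
  have hK : IsCompact ((Set.univ.pi fun x : Γ => {y : Λ | wlen T y = wlen S x}) ×ˢ
      (Set.univ.pi fun y : Λ => {x : Γ | wlen S x = wlen T y})) :=
    (isCompact_univ_pi fun x => (finite_setOf_wlen_eq hT _).isCompact).prod
      (isCompact_univ_pi fun x => (finite_setOf_wlen_eq hS _).isCompact)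
  refine (isClosedEmbedding_prod.isCompact_preimage hK).of_isClosed_subset ?_ ?_
  · rw [← isOpen_compl_iff]
    have : {f : CayleyIso S T | f.toEquiv 1 = 1}ᶜ =
        ⋃ y ∈ ({1}ᶜ : Set Λ), {f : CayleyIso S T | f.toEquiv 1 = y} := by
      ext f
      simp
    rw [this]
    exact isOpen_biUnion fun y _ => isOpen_setOf_apply_eq 1 y
  · intro f hf
    have hf : f.toEquiv 1 = 1 := hf
    have key : ∀ x, wlen T (f.toEquiv x) = wlen S x := fun x => by
      simpa [hf] using f.isom 1 x
    refine ⟨fun x _ => key x, fun y _ => ?_⟩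
    simpa using (key (f.toEquiv.symm y)).symm

theorem locallyCompactSpace (hS : IsFinGenSystem S) : LocallyCompactSpace (CayleyIso S S) :=
  (isCompact_setOf_apply_one_eq_one hS hS).locallyCompactSpace_of_mem_nhds_of_group (x := 1)
    ((isOpen_setOf_apply_eq 1 1).mem_nhds rfl)

theorem measurableSet_setOf_apply_eq (x : Γ) (y : Λ) :
    MeasurableSet {f : CayleyIso S T | f.toEquiv x = y} := by
  let _ : MeasurableSpace Λ := ⊤
  have h : Measurable fun f : CayleyIso S T => fun γ => f.toEquiv γ := comap_measurable _
  exact (measurable_pi_apply x).comp h (MeasurableSet.of_discrete (s := {y}))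

theorem measurable_of_measurableSet [Countable Λ] {Z : Type*} [MeasurableSpace Z]
    {φ : Z → CayleyIso S T} (h : ∀ x y, MeasurableSet {z | (φ z).toEquiv x = y}) :
    Measurable φ := by
  let _ : MeasurableSpace Λ := ⊤
  refine measurable_comap_iff.2 (measurable_pi_lambda _ fun x => measurable_to_countable' fun y => ?_)
  exact h x y

end CayleyIso

end IOE
namespace IOE

open ProbabilityTheory

namespace CayleyIso

variable {Γ Λ : Type*} [Group Γ] [Group Λ] {S : Set Γ} {T : Set Λ}

/-- Left multiplication by `l` combined with precomposition by left multiplication by `γ⁻¹`. -/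
def translate (l : Λ) (γ : Γ) (f : CayleyIso S T) : CayleyIso S T :=
  lsmul l (comp f (leftMult S γ⁻¹))

@[simp] theorem translate_apply (l : Λ) (γ : Γ) (f : CayleyIso S T) (x : Γ) :
    (translate l γ f).toEquiv x = l * f.toEquiv (γ⁻¹ * x) := rfl

theorem measurable_translate [Countable Λ] (l : Λ) (γ : Γ) :
    Measurable (translate l γ : CayleyIso S T → CayleyIso S T) := by
  refine measurable_of_measurableSet fun x y => ?_
  convert measurableSet_setOf_apply_eq (S := S) (T := T) (γ⁻¹ * x) (l⁻¹ * y) using 3 with f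
  rw [translate_apply, eq_inv_mul_iff_mul_eq]

/-- `translate` as a measurable automorphism. -/
def translateEquiv [Countable Λ] (l : Λ) (γ : Γ) : CayleyIso S T ≃ᵐ CayleyIso S T where
  toFun := translate l γ
  invFun := translate l⁻¹ γ⁻¹
  left_inv f := ext fun x => by simp
  right_inv f := ext fun x => by simp
  measurable_toFun := measurable_translate l γ
  measurable_invFun := measurable_translate l⁻¹ γ⁻¹

/-- The cocycle of the action `twist`. -/
def cocycle (γ : Γ) (f : CayleyIso S T) : Λ := (f.toEquiv γ⁻¹)⁻¹ * f.toEquiv 1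

/-- The action of `Γ` by precomposition, normalised so as to preserve the value at `1`. -/
def twist (γ : Γ) (f : CayleyIso S T) : CayleyIso S T :=
  translate (f.toEquiv 1 * (f.toEquiv γ⁻¹)⁻¹) γ f

theorem twist_apply (γ : Γ) (f : CayleyIso S T) (x : Γ) :
    (twist γ f).toEquiv x = f.toEquiv 1 * (f.toEquiv γ⁻¹)⁻¹ * f.toEquiv (γ⁻¹ * x) := rfl

theorem twist_apply_one (γ : Γ) (f : CayleyIso S T) :
    (twist γ f).toEquiv 1 = f.toEquiv 1 := by simp [twist_apply]

theorem one_twist (f : CayleyIso S T) : twist 1 f = f := ext fun x => by simp [twist_apply]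

theorem mul_twist (γ δ : Γ) (f : CayleyIso S T) : twist (γ * δ) f = twist γ (twist δ f) :=
  ext fun x => by simp [twist_apply, mul_assoc]

theorem bijective_twist (γ : Γ) :
    Function.Bijective (twist γ : CayleyIso S T → CayleyIso S T) := by
  refine Function.bijective_iff_has_inverse.2 ⟨twist γ⁻¹, fun f => ?_, fun f => ?_⟩
  · rw [← mul_twist, inv_mul_cancel, one_twist]
  · rw [← mul_twist, mul_inv_cancel, one_twist]

theorem cocycle_mul (γ δ : Γ) (f : CayleyIso S T) :
    cocycle (γ * δ) f = cocycle γ (twist δ f) * cocycle δ f := by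
  simp [cocycle, twist_apply, mul_assoc]

theorem bijective_cocycle (f : CayleyIso S T) : Function.Bijective fun γ => cocycle γ f :=
  ((Equiv.inv Γ).trans (f.toEquiv.trans ((Equiv.inv Λ).trans
    (Equiv.mulRight (f.toEquiv 1))))).bijective

theorem wlen_cocycle (γ : Γ) (f : CayleyIso S T) : wlen T (cocycle γ f) = wlen S γ := by
  rw [cocycle, f.isom, inv_inv, mul_one]

theorem measurableSet_apply_apply [Countable Λ] (F : Λ → Λ → Λ) (x y : Γ) (l : Λ) :
    MeasurableSet {f : CayleyIso S T | F (f.toEquiv x) (f.toEquiv y) = l} := by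
  have : {f : CayleyIso S T | F (f.toEquiv x) (f.toEquiv y) = l} =
      ⋃ a, ⋃ b, ⋃ (_ : F a b = l),
        ({f : CayleyIso S T | f.toEquiv x = a} ∩ {f : CayleyIso S T | f.toEquiv y = b}) := by
    ext f
    simp
  rw [this]
  exact .iUnion fun a => .iUnion fun b => .iUnion fun _ =>
    (measurableSet_setOf_apply_eq x a).inter (measurableSet_setOf_apply_eq y b)

theorem measurable_twist [Countable Λ] (γ : Γ) :
    Measurable (twist γ : CayleyIso S T → CayleyIso S T) :=
  measurable_of_piecewise (φ := fun l => translateEquiv l γ)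
    (k := fun f => f.toEquiv 1 * (f.toEquiv γ⁻¹)⁻¹)
    (measurableSet_apply_apply (fun a b => a * b⁻¹) 1 γ⁻¹) fun _ => rfl

theorem map_twist [Countable Λ] {μ : Measure (CayleyIso S T)} {c : ENNReal} {γ : Γ}
    (h : ∀ l, μ.map (translate l γ) = c • μ) : μ.map (twist γ) = c • μ :=
  map_eq_smul_of_piecewise (φ := fun l => translateEquiv l γ)
    (k := fun f => f.toEquiv 1 * (f.toEquiv γ⁻¹)⁻¹) h
    (measurableSet_apply_apply (fun a b => a * b⁻¹) 1 γ⁻¹) (bijective_twist γ) fun _ => rfl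

/-- A nontrivial measure on the isometry group that is invariant under left translations and
under right translations by group elements. -/
theorem exists_invariant_measure (hS : IsFinGenSystem S) :
    ∃ μ : Measure (CayleyIso S S), μ {f | f.toEquiv 1 = 1} ≠ 0 ∧ μ {f | f.toEquiv 1 = 1} ≠ ⊤ ∧
      ∀ (g : CayleyIso S S) (γ : Γ), μ.map (fun f => g * f * leftMult S γ) = μ := by
  have : Countable Γ := countable_of_isFinGenSystem hS
  have : PolishSpace (CayleyIso S S) := polishSpace
  have : LocallyCompactSpace (CayleyIso S S) := locallyCompactSpace hS
  let μ : Measure (CayleyIso S S) := Measure.haar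
  have hpos : μ {f | f.toEquiv 1 = 1} ≠ 0 :=
    ((isOpen_setOf_apply_eq 1 1).measure_pos μ ⟨1, rfl⟩).ne'
  have hfin : μ {f | f.toEquiv 1 = 1} ≠ ⊤ :=
    (isCompact_setOf_apply_one_eq_one hS hS).measure_lt_top.ne
  have hmap : ∀ g h : CayleyIso S S, μ.map (fun f => g * f * h) = μ.map (· * h) := fun g h => by
    have : (fun f => g * f * h) = (· * h) ∘ (g * ·) := rfl
    rw [this, ← Measure.map_map (measurable_mul_const h) (measurable_const_mul g),
      map_mul_left_eq_self]
  refine ⟨μ, hpos, hfin, fun g γ => ?_⟩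
  rw [hmap]
  obtain ⟨c, hc⟩ : ∃ c : ENNReal, μ.map (· * leftMult S γ) = c • μ :=
    ⟨(Measure.haarScalarFactor _ μ : NNReal), Measure.isMulLeftInvariant_eq_smul _ μ⟩
  have htw : μ.map (twist γ⁻¹) = c • μ := map_twist fun l => by
    rw [← hc, ← hmap (leftMult S l)]
    congr 1
    ext f x
    simp
  have hK : μ.map (twist γ⁻¹) {f | f.toEquiv 1 = 1} = c * μ {f | f.toEquiv 1 = 1} := by
    rw [htw, Measure.smul_apply, smul_eq_mul]
  rw [Measure.map_apply (measurable_twist _) (measurableSet_setOf_apply_eq 1 1)] at hK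
  have hpre : (twist γ⁻¹ : CayleyIso S S → CayleyIso S S) ⁻¹' {f | f.toEquiv 1 = 1} =
      {f | f.toEquiv 1 = 1} := by
    ext f
    simp [twist_apply_one]
  rw [hpre] at hK
  have hc1 : c = 1 := by
    have : 1 * μ {f | f.toEquiv 1 = 1} = c * μ {f | f.toEquiv 1 = 1} := by rwa [one_mul]
    exact ((ENNReal.mul_left_inj hpos hfin).1 this).symm
  rw [hc, hc1, one_smul]

/-- If the Cayley graphs are isometric, the twisted action on the space of isometries preserves a
probability measure. -/
theorem exists_probabilityMeasure_twist (hS : IsFinGenSystem S) (hT : IsFinGenSystem T)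
    (f₀ : CayleyIso S T) :
    ∃ P : Measure (CayleyIso S T), IsProbabilityMeasure P ∧
      ∀ γ, MeasurePreserving (twist γ) P P := by
  have : Countable Γ := countable_of_isFinGenSystem hS
  have : Countable Λ := countable_of_isFinGenSystem hT
  wlog h₀ : f₀.toEquiv 1 = 1 generalizing f₀
  · exact this (lsmul (f₀.toEquiv 1)⁻¹ f₀) (by simp)
  obtain ⟨μ, hpos, hfin, hμ⟩ := exists_invariant_measure hS
  have hm : Measurable fun g : CayleyIso S S => comp f₀ g := by
    refine measurable_of_measurableSet fun x y => ?_
    convert measurableSet_setOf_apply_eq (S := S) (T := S) x (f₀.toEquiv.symm y) using 3 with g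
    rw [Equiv.eq_symm_apply]
    rfl
  let M : Measure (CayleyIso S T) := μ.map fun g => comp f₀ g
  let K : Set (CayleyIso S T) := {f | f.toEquiv 1 = 1}
  have hKm : MeasurableSet K := measurableSet_setOf_apply_eq 1 1
  have hMK : M K = μ {f | f.toEquiv 1 = 1} := by
    rw [Measure.map_apply hm hKm]
    congr 1
    ext g
    change f₀.toEquiv (g.toEquiv 1) = 1 ↔ g.toEquiv 1 = 1
    rw [← Equiv.eq_symm_apply, (Equiv.symm_apply_eq _).2 h₀.symm]
  have hM : ∀ (l : Λ) (γ : Γ), M.map (translate l γ) = M := fun l γ => by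
    have hcomp : (translate l γ ∘ fun g : CayleyIso S S => comp f₀ g) =
        (fun g => comp f₀ g) ∘ fun g => comp f₀.inv (lsmul l f₀) * g * leftMult S γ⁻¹ := by
      funext g
      refine ext fun x => ?_
      simp [comp, inv]
    have hm' : Measurable
        fun g : CayleyIso S S => comp f₀.inv (lsmul l f₀) * g * leftMult S γ⁻¹ :=
      (measurable_mul_const _).comp (measurable_const_mul _)
    rw [Measure.map_map (measurable_translate l γ) hm, hcomp, ← Measure.map_map hm hm', hμ]
  have htw : ∀ γ, MeasurePreserving (twist γ) M M := fun γ =>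
    ⟨measurable_twist γ, by simpa using map_twist (c := 1) (γ := γ) (μ := M) (by simpa using (hM · γ))⟩
  refine ⟨cond M K, ?_, fun γ => ?_⟩
  · exact cond_isProbabilityMeasure_of_finite (hMK ▸ hpos) (hMK ▸ hfin)
  · have hpre : (twist γ : CayleyIso S T → CayleyIso S T) ⁻¹' K = K := by
      ext f
      exact (twist_apply_one γ f).congr_left
    have := ((htw γ).restrict_preimage hKm).smul_measure (M K)⁻¹
    rwa [hpre] at this

end CayleyIso

/-- The Bernoulli shift over `Γ` with base the unit interval is p.m.p. and essentially free. -/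
theorem bernoulli_shift {Γ : Type*} [Group Γ] [Countable Γ] :
    (∀ γ : Γ, MeasurePreserving (fun (z : Γ → unitInterval) x => z (x * γ))
      (Measure.infinitePi fun _ => volume) (Measure.infinitePi fun _ => volume)) ∧
    ∀ᵐ z ∂(Measure.infinitePi fun _ : Γ => (volume : Measure unitInterval)), ∀ γ : Γ,
      (fun x => z (x * γ)) = z → γ = 1 := by
  refine ⟨fun γ => ⟨by fun_prop, ?_⟩, ?_⟩
  · exact Measure.map_infinitePi_infinitePi_of_inj (mul_left_injective γ)
  · rw [ae_all_iff]
    intro γ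
    by_cases hγ : γ = 1
    · simp [hγ]
    have hmap := Measure.infinitePi_map_eval_prod
      (P := fun _ : Γ => (volume : Measure unitInterval)) hγ
    have hdiag : ∀ᵐ p ∂((volume : Measure unitInterval).prod (volume : Measure unitInterval)),
        p.1 ≠ p.2 := by
      have hd : MeasurableSet {p : unitInterval × unitInterval | p.1 ≠ p.2} :=
        (measurableSet_eq_fun measurable_fst measurable_snd).compl
      rw [Measure.ae_prod_iff_ae_ae hd]
      refine .of_forall fun a => ?_
      exact (Measure.ae_ne volume a).mono fun b hb => hb.symm
    rw [← hmap] at hdiag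
    have := ae_of_ae_map (by fun_prop) hdiag
    filter_upwards [this] with z hz h
    exact absurd (by simpa using congrFun h 1) hz

end IOE

open MeasureTheory IOE

/-- Two finitely generated groups with fixed finite generating systems
admit p.m.p. essentially free actions that are isometric orbit equivalent if and only if
their Cayley graphs are isometric. -/
theorem stmt5
    {Γ Λ : Type*} [Group Γ] [Group Λ]
    (SΓ : Set Γ) (SΛ : Set Λ) (hSΓ : IsFinGenSystem SΓ) (hSΛ : IsFinGenSystem SΛ) :
    (∃ (X Y : Type) (_ : MeasurableSpace X) (_ : MeasurableSpace Y)
        (μ : Measure X) (ν : Measure Y) (α : Γ → X → X) (β : Λ → Y → Y),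
      StandardBorelSpace X ∧ StandardBorelSpace Y ∧
      IsProbabilityMeasure μ ∧ IsProbabilityMeasure ν ∧
      IsPmpAction α μ ∧ IsPmpAction β ν ∧
      EssentiallyFree α μ ∧ EssentiallyFree β ν ∧
      IsomOrbitEquiv α SΓ μ β SΛ ν) ↔
    Nonempty (CayleyIso SΓ SΛ) := by
  constructor
  · rintro ⟨X, Y, _, _, μ, ν, α, β, -, -, hμ, -, hα, hβ, hfα, hfβ, h⟩
    exact nonempty_cayleyIso_of_isomOrbitEquiv hSΓ.toIsGenSystem hSΛ.toIsGenSystem hα hβ hfα hfβ h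
  · rintro ⟨f₀⟩
    have : Countable Γ := countable_of_isFinGenSystem hSΓ
    have : Countable Λ := countable_of_isFinGenSystem hSΛ
    have : PolishSpace (CayleyIso SΓ SΛ) := CayleyIso.polishSpace
    obtain ⟨P, hP, htw⟩ := CayleyIso.exists_probabilityMeasure_twist hSΓ hSΛ f₀
    obtain ⟨hshift, hfree⟩ := bernoulli_shift (Γ := Γ)
    let Q : Measure (Γ → unitInterval) := Measure.infinitePi fun _ => volume
    refine exists_actions_of_cocycle (X := CayleyIso SΓ SΛ × (Γ → unitInterval)) (μ := P.prod Q)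
      (α := fun γ p => (CayleyIso.twist γ p.1, fun x => p.2 (x * γ)))
      hSΓ.toIsGenSystem hSΛ.toIsGenSystem ⟨fun p => ?_, fun γ δ p => ?_, fun γ => ?_⟩ ?_
      (fun γ p => CayleyIso.cocycle γ p.1) (fun γ l => ?_)
      (fun γ δ p => CayleyIso.cocycle_mul γ δ p.1) (fun p => CayleyIso.bijective_cocycle p.1)
      (fun γ p => CayleyIso.wlen_cocycle γ p.1)
    · simp [CayleyIso.one_twist]
    · simp [CayleyIso.mul_twist, mul_assoc]
    · exact (htw γ).prod (hshift γ)
    · filter_upwards [Measure.quasiMeasurePreserving_snd.ae hfree] with p hp γ hγ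
      exact hp γ (congrArg Prod.snd hγ)
    · exact measurable_fst
        (CayleyIso.measurableSet_apply_apply (fun a b => a⁻¹ * b) γ⁻¹ 1 l)
end

section
/- Let Γ = ⟨S_Γ⟩ be a finitely generated group and Λ ≤ Γ a finite index subgroup. Let m_Λ be the Haar probability measure on Iso(Γ)/Λ, μ the Haar probability measure on Iso₁(Γ), and u the uniform probability measure on Γ/Λ. Then the p.m.p. action Iso(Γ) ↷ (Iso(Γ)/Λ, m_Λ) is measurably isomorphic to the p.m.p. action of Iso(Γ) on (Iso₁(Γ) × Γ/Λ, μ ⊗ u) given by g(f,q) := (g·f, f(g⁻¹(1_Γ))⁻¹ q). -/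
open MeasureTheory

namespace IOE

variable {Γ : Type*} [Group Γ]

/-- The action of `Iso(Γ)` on itself by pre-composition by the inverse (i.e. right
translation), descended to the quotient `Iso(Γ)/Λ` of `Iso(Γ)` by the post-composition
action of a subgroup `Λ ≤ Γ`. -/
def subQ {S : Set Γ} (Λ : Subgroup Γ) (g : CayleyIso S S) :
    Quotient (MulAction.orbitRel ↥Λ (CayleyIso S S)) →
      Quotient (MulAction.orbitRel ↥Λ (CayleyIso S S)) :=
  Quotient.map (fun f => f * g⁻¹) (by
    intro a b hab
    obtain ⟨l, rfl⟩ := hab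
    exact ⟨l, CayleyIso.ext fun x => rfl⟩)

/-- The natural action of `Iso(Γ)` on `Iso₁(Γ)`: `(g · f)(δ) = f(g⁻¹(1))⁻¹ f(g⁻¹(δ))`. -/
def natActIso {S : Set Γ} (g : CayleyIso S S) (f : Iso1 S S) : Iso1 S S :=
  ⟨CayleyIso.lsmul (f.1.toEquiv (g.toEquiv.symm 1))⁻¹ (f.1 * g⁻¹), by
    show (f.1.toEquiv (g.toEquiv.symm 1))⁻¹ * (f.1 * g⁻¹).toEquiv 1 = 1
    exact inv_mul_cancel _⟩

end IOE

namespace IOE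

section Measurability

variable {Γ Λ X : Type*} [Group Γ] [Group Λ] [MeasurableSpace X] {S : Set Γ} {T : Set Λ}

theorem IsFinGenSystem.countable {S : Set Γ} (hS : IsFinGenSystem S) : Countable Γ := by
  have := hS.finite.to_subtype
  refine Function.Surjective.countable (f := FreeGroup.lift ((↑) : S → Γ)) ?_
  rw [← MonoidHom.range_eq_top, ← FreeGroup.closure_eq_range, hS.closure_eq_top]

theorem CayleyIso.measurableSet_eval_eq (x : Γ) (y : Λ) :
    MeasurableSet {f : CayleyIso S T | f.toEquiv x = y} := by
  let _ : MeasurableSpace Λ := ⊤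
  have h : Measurable fun (f : CayleyIso S T) (γ : Γ) => f.toEquiv γ := comap_measurable _
  exact (measurable_pi_iff.mp h x) (MeasurableSpace.measurableSet_top (s := {y}))

theorem CayleyIso.measurable_of_eval [Countable Λ] {F : X → CayleyIso S T}
    (h : ∀ x y, MeasurableSet {a | (F a).toEquiv x = y}) : Measurable F := by
  let _ : MeasurableSpace Λ := ⊤
  refine measurable_comap_iff.mpr (measurable_pi_iff.mpr fun x => ?_)
  exact measurable_to_countable' fun y => h x y

namespace Iso1

theorem measurable_val : Measurable (Subtype.val : Iso1 S T → CayleyIso S T) :=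
  measurable_subtype_coe

theorem measurableSet_eval_eq (x : Γ) (y : Λ) :
    MeasurableSet {f : Iso1 S T | f.1.toEquiv x = y} :=
  measurable_val (CayleyIso.measurableSet_eval_eq x y)

theorem measurable_of_eval [Countable Λ] {F : X → Iso1 S T}
    (h : ∀ x y, MeasurableSet {a | (F a).1.toEquiv x = y}) : Measurable F :=
  Measurable.subtype_mk (f := fun a => (F a).1) (h := fun a => (F a).2)
    (CayleyIso.measurable_of_eval h)

theorem measurable_pre1_uncurry [Countable Γ] [Countable Λ] :
    Measurable fun p : Iso1 S S × Iso1 S T => pre1 p.1 p.2 := by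
  refine measurable_of_eval fun x y => ?_
  have : {p : Iso1 S S × Iso1 S T | (pre1 p.1 p.2).1.toEquiv x = y} =
      ⋃ z, {h : Iso1 S S | h.1.toEquiv x = z} ×ˢ {f : Iso1 S T | f.1.toEquiv z = y} := by
    ext p
    simp [pre1, CayleyIso.comp]
  rw [this]
  exact .iUnion fun z => (measurableSet_eval_eq x z).prod (measurableSet_eval_eq z y)

end Iso1

end Measurability

section Normalization

variable {Γ : Type*} [Group Γ] {S : Set Γ}

/-- The isometry `f` translated so as to fix the identity. -/
def normalize (f : CayleyIso S S) : Iso1 S S :=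
  ⟨(f.toEquiv 1)⁻¹ • f, by simp⟩

theorem measurable_normalize [Countable Γ] : Measurable (normalize (S := S)) := by
  refine Iso1.measurable_of_eval fun x y => ?_
  have : {f : CayleyIso S S | (normalize f).1.toEquiv x = y} =
      ⋃ z, {f | f.toEquiv 1 = z} ∩ {f | f.toEquiv x = z * y} := by
    ext f
    simp [normalize, inv_mul_eq_iff_eq_mul]
  rw [this]
  exact .iUnion fun z =>
    (CayleyIso.measurableSet_eval_eq 1 z).inter (CayleyIso.measurableSet_eval_eq x (z * y))

theorem measurable_smul_iso1 [Countable Γ] (γ : Γ) :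
    Measurable fun f : Iso1 S S => γ • f.1 := by
  refine CayleyIso.measurable_of_eval fun x y => ?_
  simpa [← eq_inv_mul_iff_mul_eq] using Iso1.measurableSet_eval_eq (S := S) (T := S) x (γ⁻¹ * y)

/-- The bijection `Λ f ↦ (f(1)⁻¹ f, f(1)⁻¹ Λ)` from `Iso(Γ)/Λ` onto `Iso₁(Γ) × Γ/Λ`. -/
def quotientEquiv (S : Set Γ) (Λ : Subgroup Γ) :
    Quotient (MulAction.orbitRel ↥Λ (CayleyIso S S)) ≃ (Iso1 S S × Γ ⧸ Λ) where
  toFun := Quotient.lift (fun f => (normalize f, (((f.toEquiv 1)⁻¹ : Γ) : Γ ⧸ Λ))) (by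
    rintro _ b ⟨l, rfl⟩
    have hl (x : Γ) : (l • b).toEquiv x = l * b.toEquiv x := rfl
    refine Prod.ext (Subtype.ext (CayleyIso.ext fun x => ?_)) ?_
    · simp [normalize, hl, mul_assoc]
    · simp [hl])
  invFun p := Quotient.lift (s := QuotientGroup.leftRel Λ)
    (fun γ : Γ => (Quotient.mk _ (γ⁻¹ • p.1.1) :
      Quotient (MulAction.orbitRel ↥Λ (CayleyIso S S)))) (by
    intro a b hab
    have hab : a⁻¹ * b ∈ Λ := QuotientGroup.leftRel_apply.mp hab
    refine Quotient.sound ⟨⟨a⁻¹ * b, hab⟩, CayleyIso.ext fun x => ?_⟩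
    show a⁻¹ * b * (b⁻¹ * p.1.1.toEquiv x) = a⁻¹ * p.1.1.toEquiv x
    group) p.2
  left_inv := by
    rintro ⟨f⟩
    refine congrArg (Quotient.mk _) (CayleyIso.ext fun x => ?_)
    simp [normalize]
  right_inv := by
    rintro ⟨f, ⟨γ⟩⟩
    refine Prod.ext (Subtype.ext (CayleyIso.ext fun x => ?_)) ?_
    · show (γ⁻¹ * f.1.toEquiv 1)⁻¹ * (γ⁻¹ * f.1.toEquiv x) = _
      simp [f.2]
    · show (((γ⁻¹ * f.1.toEquiv 1)⁻¹ : Γ) : Γ ⧸ Λ) = _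
      rw [f.2]
      simp
      rfl

theorem measurable_quotientEquiv [Countable Γ] (Λ : Subgroup Γ) [MeasurableSpace (Γ ⧸ Λ)] :
    Measurable (quotientEquiv S Λ) := by
  refine measurable_from_quotient.mpr (measurable_normalize.prodMk ?_)
  let _ : MeasurableSpace Γ := ⊤
  have h : Measurable fun f : CayleyIso S S => f.toEquiv 1 :=
    measurable_to_countable' fun y => CayleyIso.measurableSet_eval_eq 1 y
  exact (measurable_from_top (f := fun x : Γ => ((x⁻¹ : Γ) : Γ ⧸ Λ))).comp h

theorem measurable_quotientEquiv_symm [Countable Γ] (Λ : Subgroup Γ) [MeasurableSpace (Γ ⧸ Λ)]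
    [DiscreteMeasurableSpace (Γ ⧸ Λ)] : Measurable (quotientEquiv S Λ).symm := by
  have : Countable (Γ ⧸ Λ) := Quotient.countable
  refine measurable_from_prod_countable_left fun q => ?_
  obtain ⟨γ, rfl⟩ := QuotientGroup.mk_surjective q
  exact measurable_quotient_mk''.comp (measurable_smul_iso1 γ⁻¹)

theorem quotientEquiv_subQ (Λ : Subgroup Γ) (g : CayleyIso S S)
    (x : Quotient (MulAction.orbitRel ↥Λ (CayleyIso S S))) :
    quotientEquiv S Λ (subQ Λ g x) =
      (natActIso g (quotientEquiv S Λ x).1,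
        ((quotientEquiv S Λ x).1.1.toEquiv (g.toEquiv.symm 1))⁻¹ • (quotientEquiv S Λ x).2) := by
  obtain ⟨f⟩ := x
  refine Prod.ext (Subtype.ext (CayleyIso.ext fun x => ?_)) ?_
  · show (f.toEquiv (g.toEquiv.symm 1))⁻¹ * f.toEquiv (g.toEquiv.symm x) =
      ((f.toEquiv 1)⁻¹ * f.toEquiv (g.toEquiv.symm 1))⁻¹ *
        ((f.toEquiv 1)⁻¹ * f.toEquiv (g.toEquiv.symm x))
    group
  · show (((f.toEquiv (g.toEquiv.symm 1))⁻¹ : Γ) : Γ ⧸ Λ) =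
      ((((f.toEquiv 1)⁻¹ * f.toEquiv (g.toEquiv.symm 1))⁻¹ * (f.toEquiv 1)⁻¹ : Γ) : Γ ⧸ Λ)
    congr 1
    group

end Normalization

section Uniqueness

variable {Γ : Type*} [Group Γ] {S : Set Γ}

/-- The action `g(f, q) = (g·f, f(g⁻¹(1))⁻¹ q)` of `Iso(Γ)` on `Iso₁(Γ) × Γ/Λ`. -/
def prodAct (Λ : Subgroup Γ) (g : CayleyIso S S) (p : Iso1 S S × Γ ⧸ Λ) : Iso1 S S × Γ ⧸ Λ :=
  (natActIso g p.1, (p.1.1.toEquiv (g.toEquiv.symm 1))⁻¹ • p.2)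

theorem prodAct_inv_iso1 (Λ : Subgroup Γ) (h : Iso1 S S) (p : Iso1 S S × Γ ⧸ Λ) :
    prodAct Λ h.1⁻¹ p = (Iso1.pre1 h p.1, p.2) := by
  have h1 : p.1.1.toEquiv (h.1.toEquiv 1) = 1 := by rw [h.2, p.1.2]
  refine Prod.ext (Subtype.ext (CayleyIso.ext fun x => ?_)) ?_
  · show (p.1.1.toEquiv (h.1.toEquiv 1))⁻¹ * p.1.1.toEquiv (h.1.toEquiv x) =
      p.1.1.toEquiv (h.1.toEquiv x)
    rw [h1, inv_one, one_mul]
  · show (p.1.1.toEquiv (h.1.toEquiv 1))⁻¹ • p.2 = p.2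
    rw [h1, inv_one, one_smul]

/-- A measure on `Iso₁(Γ) × Y` invariant under right translations of the first factor is the
product of the Haar measure with its second marginal. -/
theorem eq_prod_snd_of_pre1_invariant [Countable Γ] {Y : Type*} [MeasurableSpace Y]
    (μ : Measure (Iso1 S S)) [IsProbabilityMeasure μ]
    (hμ : ∀ h : Iso1 S S, MeasurePreserving (Iso1.post1 h) μ μ)
    (ν : Measure (Iso1 S S × Y)) [IsFiniteMeasure ν]
    (hν : ∀ h : Iso1 S S, MeasurePreserving (fun p : Iso1 S S × Y => (Iso1.pre1 h p.1, p.2)) ν ν) :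
    ν = μ.prod ν.snd := by
  refine (Measure.prod_eq fun s t hs ht => ?_).symm
  let E : Set (Iso1 S S × (Iso1 S S × Y)) := {a | Iso1.pre1 a.1 a.2.1 ∈ s ∧ a.2.2 ∈ t}
  have hE : MeasurableSet E := by
    have h1 : Measurable fun a : Iso1 S S × (Iso1 S S × Y) => Iso1.pre1 a.1 a.2.1 :=
      Iso1.measurable_pre1_uncurry.comp
        (measurable_fst.prodMk (measurable_fst.comp measurable_snd))
    exact (h1 hs).inter ((measurable_snd.comp measurable_snd) ht)
  have hleft : μ.prod ν E = ν (s ×ˢ t) := by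
    rw [Measure.prod_apply hE]
    have (h : Iso1 S S) : ν (Prod.mk h ⁻¹' E) = ν (s ×ˢ t) :=
      (hν h).measure_preimage (hs.prod ht).nullMeasurableSet
    simp [this]
  have hright : μ.prod ν E = μ s * ν.snd t := by
    rw [Measure.prod_apply_symm hE]
    have (p : Iso1 S S × Y) : μ ((fun h => (h, p)) ⁻¹' E) =
        (Prod.snd ⁻¹' t).indicator (fun _ => μ s) p := by
      by_cases hp : p.2 ∈ t
      · rw [Set.indicator_of_mem (by exact hp), ← (hμ p.1).measure_preimage hs.nullMeasurableSet]
        congr 1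
        ext h
        simp [E, hp, Iso1.pre1, Iso1.post1]
      · rw [Set.indicator_of_notMem (by exact hp)]
        simp [E, hp]
    simp_rw [this]
    rw [lintegral_indicator_const (measurable_snd ht), Measure.snd_apply ht]
  rw [← hleft, hright]

theorem measure_fixing_ne_zero [Countable Γ] (μ : Measure (Iso1 S S)) [NeZero μ]
    (hμ : ∀ h : Iso1 S S, MeasurePreserving (Iso1.post1 h) μ μ) (γ : Γ) :
    μ {f | f.1.toEquiv γ = γ} ≠ 0 := by
  intro h0
  refine NeZero.ne μ (Measure.measure_univ_eq_zero.mp ?_)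
  have : (Set.univ : Set (Iso1 S S)) = ⋃ δ, {f | f.1.toEquiv γ = δ} := by
    ext f
    simp
  rw [this]
  refine measure_iUnion_null fun δ => ?_
  rcases Set.eq_empty_or_nonempty {f : Iso1 S S | f.1.toEquiv γ = δ} with he | ⟨f₀, hf₀⟩
  · rw [he, measure_empty]
  · rw [← h0, ← (hμ f₀.inv1).measure_preimage
      (Iso1.measurableSet_eval_eq γ γ).nullMeasurableSet]
    congr 1
    ext f
    show f.1.toEquiv γ = δ ↔ f₀.1.toEquiv.symm (f.1.toEquiv γ) = γ
    rw [Equiv.symm_apply_eq, show f₀.1.toEquiv γ = δ from hf₀]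

/-- The second marginal of an invariant probability measure gives all cosets the same mass. -/
theorem measure_singleton_eq [Countable Γ] (Λ : Subgroup Γ) [Λ.FiniteIndex]
    [MeasurableSpace (Γ ⧸ Λ)] [DiscreteMeasurableSpace (Γ ⧸ Λ)]
    (μ : Measure (Iso1 S S)) [IsProbabilityMeasure μ]
    (hμ : ∀ h : Iso1 S S, MeasurePreserving (Iso1.post1 h) μ μ)
    (w : Measure (Γ ⧸ Λ)) [IsFiniteMeasure w]
    (hw : ∀ g : CayleyIso S S, MeasurePreserving (prodAct Λ g) (μ.prod w) (μ.prod w))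
    (q q' : Γ ⧸ Λ) : w {q} = w {q'} := by
  obtain ⟨m, hm⟩ := Finite.exists_max fun q : Γ ⧸ Λ => w {q}
  suffices h : ∀ q, w {q} = w {m} by rw [h q, h q']
  intro q
  obtain ⟨γ, rfl⟩ := MulAction.exists_smul_eq Γ m q
  have hmean : ∫⁻ f : Iso1 S S, w {f.1.toEquiv γ • m} ∂μ = w {m} := by
    have hset : MeasurableSet (Set.univ ×ˢ {m} : Set (Iso1 S S × Γ ⧸ Λ)) :=
      MeasurableSet.univ.prod (.of_discrete)
    have h := (hw (CayleyIso.leftMult S γ⁻¹)).measure_preimage hset.nullMeasurableSet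
    rw [Measure.prod_prod, measure_univ, one_mul,
      Measure.prod_apply ((hw _).measurable hset)] at h
    rw [← h]
    refine lintegral_congr fun f => congrArg w ?_
    ext r
    have hγ : (CayleyIso.leftMult S γ⁻¹).toEquiv.symm 1 = γ :=
      (Equiv.symm_apply_eq _).mpr (by simp)
    simp [prodAct, hγ, inv_smul_eq_iff]
  have hae : (fun f : Iso1 S S => w {f.1.toEquiv γ • m}) =ᵐ[μ] fun _ => w {m} :=
    ae_eq_of_ae_le_of_lintegral_le (ae_of_all _ fun f => hm _) (by simp [hmean])
      aemeasurable_const (by simp [hmean])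
  by_contra hne
  refine measure_fixing_ne_zero μ hμ γ (measure_mono_null (fun f hf => ?_) (ae_iff.mp hae))
  simpa [show f.1.toEquiv γ = γ from hf] using hne

theorem eq_prod_of_prodAct_invariant [Countable Γ] (Λ : Subgroup Γ) [Λ.FiniteIndex]
    [MeasurableSpace (Γ ⧸ Λ)] [DiscreteMeasurableSpace (Γ ⧸ Λ)]
    (μ : Measure (Iso1 S S)) [IsProbabilityMeasure μ]
    (hμ : ∀ h : Iso1 S S, MeasurePreserving (Iso1.post1 h) μ μ)
    (u : Measure (Γ ⧸ Λ)) (hu : ∀ q : Γ ⧸ Λ, u {q} = (Nat.card (Γ ⧸ Λ) : ENNReal)⁻¹)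
    (ν : Measure (Iso1 S S × Γ ⧸ Λ)) [IsProbabilityMeasure ν]
    (hν : ∀ g : CayleyIso S S, MeasurePreserving (prodAct Λ g) ν ν) :
    ν = μ.prod u := by
  have hprod : ν = μ.prod ν.snd := eq_prod_snd_of_pre1_invariant μ hμ ν fun h => by
    simpa only [funext (prodAct_inv_iso1 Λ h)] using hν h.1⁻¹
  suffices ν.snd = u by rw [hprod, this]
  have hconst := measure_singleton_eq Λ μ hμ ν.snd (by rwa [← hprod])
  have := Fintype.ofFinite (Γ ⧸ Λ)
  refine Measure.ext_of_singleton fun q => ?_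
  rw [hu]
  refine ENNReal.eq_inv_of_mul_eq_one_left ?_
  have hsum : ∑ r, ν.snd {r} = 1 := by
    rw [sum_measure_singleton, Finset.coe_univ, measure_univ]
  simpa [hconst _ q, mul_comm, Nat.card_eq_fintype_card] using hsum

end Uniqueness

end IOE

open MeasureTheory IOE

/-- For a finite index subgroup `Λ ≤ Γ`, the p.m.p. action
`Iso(Γ) ↷ (Iso(Γ)/Λ, m_Λ)` is measurably isomorphic to the p.m.p. action of `Iso(Γ)` on
`(Iso₁(Γ) × Γ/Λ, μ ⊗ u)` given by `g(f,q) = (g·f, f(g⁻¹(1))⁻¹ q)`. -/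
theorem stmt8
    {Γ : Type*} [Group Γ]
    (SΓ : Set Γ) (hSΓ : IsFinGenSystem SΓ)
    (Λ : Subgroup Γ) [Λ.FiniteIndex]
    [MeasurableSpace (Γ ⧸ Λ)] [DiscreteMeasurableSpace (Γ ⧸ Λ)]
    -- the Haar probability measure `m_Λ` on `Iso(Γ)/Λ`
    (mΛ : Measure (Quotient (MulAction.orbitRel ↥Λ (CayleyIso SΓ SΓ))))
    [IsProbabilityMeasure mΛ]
    (hmΛ : ∀ g : CayleyIso SΓ SΓ, MeasurePreserving (subQ Λ g) mΛ mΛ)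
    -- the Haar probability measure `μ` on `Iso₁(Γ)`
    (μ : Measure (Iso1 SΓ SΓ)) [IsProbabilityMeasure μ]
    (hμpre : ∀ h : Iso1 SΓ SΓ, MeasurePreserving (Iso1.pre1 h) μ μ)
    (hμpost : ∀ h : Iso1 SΓ SΓ, MeasurePreserving (Iso1.post1 h) μ μ)
    -- the uniform probability measure `u` on `Γ/Λ`
    (u : Measure (Γ ⧸ Λ)) [IsProbabilityMeasure u]
    (hu : ∀ q : Γ ⧸ Λ, u {q} = (Nat.card (Γ ⧸ Λ) : ENNReal)⁻¹) :
    ∃ Ψ : Quotient (MulAction.orbitRel ↥Λ (CayleyIso SΓ SΓ)) ≃ (Iso1 SΓ SΓ × Γ ⧸ Λ),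
      Measurable Ψ ∧ Measurable Ψ.symm ∧ MeasurePreserving Ψ mΛ (μ.prod u) ∧
      ∀ g : CayleyIso SΓ SΓ,
        ∀ᵐ x ∂mΛ, Ψ (subQ Λ g x)
          = (natActIso g (Ψ x).1, ((Ψ x).1.1.toEquiv (g.toEquiv.symm 1))⁻¹ • (Ψ x).2) := by
  have := hSΓ.countable
  have hΨ := measurable_quotientEquiv (S := SΓ) Λ
  have hΨs := measurable_quotientEquiv_symm (S := SΓ) Λ
  refine ⟨quotientEquiv SΓ Λ, hΨ, hΨs, ⟨hΨ, ?_⟩, fun g => ae_of_all _ (quotientEquiv_subQ Λ g)⟩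
  have := Measure.isProbabilityMeasure_map (μ := mΛ) hΨ.aemeasurable
  refine eq_prod_of_prodAct_invariant Λ μ hμpost u hu _ fun g => ?_
  have hconj : prodAct Λ g = quotientEquiv SΓ Λ ∘ subQ Λ g ∘ (quotientEquiv SΓ Λ).symm := by
    funext p
    simp [quotientEquiv_subQ, prodAct]
  rw [hconj]
  have hΨmp : MeasurePreserving (quotientEquiv SΓ Λ) mΛ (mΛ.map (quotientEquiv SΓ Λ)) := ⟨hΨ, rfl⟩
  have hΨsmp : MeasurePreserving (quotientEquiv SΓ Λ).symm (mΛ.map (quotientEquiv SΓ Λ)) mΛ :=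
    ⟨hΨs, by rw [Measure.map_map hΨs hΨ, Equiv.symm_comp_self, Measure.map_id]⟩
  exact hΨmp.comp ((hmΛ g).comp hΨsmp)
end
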